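/- arXiv:2503.05013 — 5 statements merged into one kernel-verified Lean document; each statement's English description precedes it below -/
import Mathlib

section
/- For every non-negative integer n and every natural number m ≥ 1, the Fuss-Catalan number of order three C3(n) = binom(3n,n)/(2n+1) divides S(2n,m); equivalently, binom(3n,n) divides (2n+1)*S(2n,m). -/
/-- Catalan triangle number `C(N,k) = binom(N+k,N) - binom(N+k,N+1)`. -/
def catT (N k : ℕ) : ℤ := ((N + k).choose N : ℤ) - ((N + k).choose (N + 1) : ℤ)

/-- `S(2n,m) = Σ_{k=0}^{2n} (-1)^k binom(2n,k)^m C(2n,k) C(2n,2n-k)`. -/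
def S (n m : ℕ) : ℤ :=
  ∑ k ∈ Finset.range (2 * n + 1),
    (-1) ^ k * ((2 * n).choose k : ℤ) ^ m * catT (2 * n) k * catT (2 * n) (2 * n - k)

/-- The factorial of an integer, as a rational number; it is `1` at negative integers. -/
def intFactorial (z : ℤ) : ℚ := (z.toNat.factorial : ℚ)

/-- The reciprocal factorial of an integer, with the value `0` at negative integers. -/
def invFactorial (z : ℤ) : ℚ := if z < 0 then 0 else (intFactorial z)⁻¹

theorem intFactorial_natCast (n : ℕ) : intFactorial n = n.factorial := by
  simp [intFactorial]

theorem intFactorial_ne_zero (z : ℤ) : intFactorial z ≠ 0 := by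
  simp [intFactorial, Nat.factorial_ne_zero]

theorem intFactorial_add_one {z : ℤ} (hz : 0 ≤ z) :
    intFactorial (z + 1) = (z + 1) * intFactorial z := by
  lift z to ℕ using hz
  rw [show (z : ℤ) + 1 = ((z + 1 : ℕ) : ℤ) by push_cast; ring, intFactorial_natCast,
    intFactorial_natCast, Nat.factorial_succ]
  push_cast
  ring

theorem invFactorial_of_neg {z : ℤ} (hz : z < 0) : invFactorial z = 0 := if_pos hz

theorem invFactorial_of_nonneg {z : ℤ} (hz : 0 ≤ z) : invFactorial z = (intFactorial z)⁻¹ :=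
  if_neg hz.not_gt

theorem invFactorial_natCast (n : ℕ) : invFactorial n = (n.factorial : ℚ)⁻¹ := by
  rw [invFactorial_of_nonneg (Int.natCast_nonneg n), intFactorial_natCast]

theorem invFactorial_eq_add_one_mul (z : ℤ) :
    invFactorial z = (z + 1) * invFactorial (z + 1) := by
  rcases lt_trichotomy z (-1) with h | rfl | h
  · rw [invFactorial_of_neg (by omega), invFactorial_of_neg (by omega), mul_zero]
  · rw [invFactorial_of_neg (by omega)]
    simp
  · have h0 : (0 : ℤ) ≤ z := by omega
    rw [invFactorial_of_nonneg h0, invFactorial_of_nonneg (by omega), intFactorial_add_one h0]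
    have := intFactorial_ne_zero z
    have h1 : (z : ℚ) + 1 ≠ 0 := by exact_mod_cast (by omega : z + 1 ≠ 0)
    field_simp

theorem intFactorial_mul_invFactorial {z : ℤ} (hz : 0 ≤ z) :
    intFactorial z * invFactorial z = 1 := by
  rw [invFactorial_of_nonneg hz, mul_inv_cancel₀ (intFactorial_ne_zero z)]

/-- The summand of the well-poised sum in Dixon's theorem. -/
def dixonTerm (a c d s : ℤ) : ℚ :=
  intFactorial (d + s) * intFactorial (d - s) * invFactorial (a + s) * invFactorial (a - s) *
    invFactorial (c + s) * invFactorial (c - s)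

/-- The telescoping certificate for `dixonTerm`. -/
def dixonCertificate (a c d s : ℤ) : ℚ :=
  -(1 / 2) * (intFactorial (d + s) * intFactorial (d + 1 - s) * invFactorial (a + s) *
    invFactorial (a + 1 - s) * invFactorial (c + s - 1) * invFactorial (c - s))

theorem dixonTerm_telescope {a c d s : ℤ} (h1 : 0 ≤ d + s) (h2 : 0 ≤ d - s) :
    (a + 1) * (d - a) * (a + c + 1) * dixonTerm (a + 1) c d s - (d - a - c) * dixonTerm a c d s =
      -dixonCertificate a c d (s + 1) - dixonCertificate a c d s := by
  have e1 := intFactorial_add_one h1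
  have e2 := intFactorial_add_one h2
  have e3 := invFactorial_eq_add_one_mul (a + s)
  have e4 := invFactorial_eq_add_one_mul (a - s)
  have e5 := invFactorial_eq_add_one_mul (c + s - 1)
  have e6 := invFactorial_eq_add_one_mul (c - s - 1)
  unfold dixonTerm dixonCertificate
  rw [show d + (s + 1) = d + s + 1 by ring, show d + 1 - (s + 1) = d - s by ring,
    show a + (s + 1) = a + s + 1 by ring, show a + 1 - (s + 1) = a - s by ring,
    show c + (s + 1) - 1 = c + s by ring, show c - (s + 1) = c - s - 1 by ring,
    show d + 1 - s = d - s + 1 by ring, show a + 1 - s = a - s + 1 by ring,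
    show a + 1 + s = a + s + 1 by ring, e1, e2, e3, e4, e5, e6,
    show c + s - 1 + 1 = c + s by ring, show c - s - 1 + 1 = c - s by ring]
  push_cast
  ring

theorem sum_dixonTerm_succ {a R d : ℕ} (c : ℕ) (ha : a + 1 ≤ R) (hd : R ≤ d) :
    ((a : ℚ) + 1) * (d - a) * (a + c + 1) *
        ∑ i ∈ Finset.range (2 * R + 1), (-1) ^ i * dixonTerm (a + 1) c d (i - R) =
      (d - a - c) * ∑ i ∈ Finset.range (2 * R + 1), (-1) ^ i * dixonTerm a c d (i - R) := by
  rw [← sub_eq_zero, Finset.mul_sum, Finset.mul_sum, ← Finset.sum_sub_distrib]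
  have key := Finset.sum_range_sub
    (fun i : ℕ => (-1 : ℚ) ^ i * dixonCertificate a c d (i - R)) (2 * R + 1)
  have hfirst : dixonCertificate a c d (((0 : ℕ) : ℤ) - R) = 0 := by
    unfold dixonCertificate
    rw [invFactorial_of_neg (z := (a : ℤ) + (((0 : ℕ) : ℤ) - R)) (by push_cast; omega)]
    ring
  have hlast : dixonCertificate a c d (((2 * R + 1 : ℕ) : ℤ) - R) = 0 := by
    unfold dixonCertificate
    rw [invFactorial_of_neg (z := (a : ℤ) + 1 - (((2 * R + 1 : ℕ) : ℤ) - R))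
      (by push_cast; omega)]
    ring
  rw [hfirst, hlast, mul_zero, mul_zero, sub_zero] at key
  rw [← key]
  refine Finset.sum_congr rfl fun i hi => ?_
  have hi := Finset.mem_range.mp hi
  have h := dixonTerm_telescope (a := a) (c := c) (d := d) (s := (i : ℤ) - R)
    (by omega) (by omega)
  rw [show (((i + 1 : ℕ) : ℤ) - R) = (i : ℤ) - R + 1 by push_cast; ring, pow_succ]
  push_cast at h
  linear_combination (-1 : ℚ) ^ i * h

/-- A terminating form of Dixon's theorem on well-poised `₃F₂` sums. -/
theorem sum_dixonTerm {a R c d : ℕ} (ha : a ≤ R) (hd : R ≤ d) (hc : c ≤ d) :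
    ∑ i ∈ Finset.range (2 * R + 1), (-1) ^ i * dixonTerm a c d (i - R) =
      (-1) ^ R * (intFactorial d * intFactorial (d - c) * intFactorial (d - a) *
        invFactorial a * invFactorial c * invFactorial (a + c) * invFactorial (d - c - a)) := by
  induction a with
  | zero =>
    rw [Finset.sum_eq_single R]
    · have h := intFactorial_mul_invFactorial (z := (d : ℤ) - c) (by omega)
      have h0 : invFactorial 0 = 1 := by simpa using invFactorial_natCast 0
      simp only [dixonTerm, sub_self, add_zero, sub_zero, Nat.cast_zero, zero_add, h0]
      linear_combination
        -(-1 : ℚ) ^ R * intFactorial d * intFactorial d * invFactorial c * invFactorial c * h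
    · intro i _ hi
      unfold dixonTerm
      rcases lt_or_gt_of_ne hi with h | h
      · rw [invFactorial_of_neg (z := ((0 : ℕ) : ℤ) + (i - R)) (by push_cast; omega)]
        ring
      · rw [invFactorial_of_neg (z := ((0 : ℕ) : ℤ) - (i - R)) (by push_cast; omega)]
        ring
    · intro h
      exact absurd (Finset.mem_range.mpr (by omega)) h
  | succ a ih =>
    have hrec := sum_dixonTerm_succ c ha hd
    rw [ih (by omega)] at hrec
    have hda : (d : ℚ) - a ≠ 0 := by
      have : (a : ℚ) < d := by exact_mod_cast (by omega : a < d)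
      linarith
    have ha1 : (a : ℚ) + 1 ≠ 0 := by positivity
    have hac : (a : ℚ) + c + 1 ≠ 0 := by positivity
    refine mul_left_cancel₀ (mul_ne_zero (mul_ne_zero ha1 hda) hac) ?_
    push_cast
    rw [hrec]
    have e1 := invFactorial_eq_add_one_mul a
    have e2 := invFactorial_eq_add_one_mul (a + c)
    have e3 := invFactorial_eq_add_one_mul (d - c - a - 1)
    have e4 := intFactorial_add_one (z := (d : ℤ) - a - 1) (by omega)
    rw [show (d : ℤ) - c - a - 1 + 1 = d - c - a by ring] at e3
    rw [show (d : ℤ) - a - 1 + 1 = d - a by ring] at e4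
    rw [show (d : ℤ) - (a + 1) = d - a - 1 by ring, show (a : ℤ) + 1 + c = a + c + 1 by ring,
      show (d : ℤ) - c - (a + 1) = d - c - a - 1 by ring, e1, e2, e3, e4]
    push_cast
    ring

theorem choose_eq_factorials {n k : ℕ} (h : k ≤ n) :
    (n.choose k : ℚ) = intFactorial n * invFactorial k * invFactorial (n - k) := by
  rw [Nat.cast_choose ℚ h, ← Nat.cast_sub h, intFactorial_natCast, invFactorial_natCast,
    invFactorial_natCast]
  field_simp

theorem catT_eq (N k : ℕ) :
    (catT N k : ℚ) = (N + 1 - k) * intFactorial (N + k) * invFactorial (N + 1) * invFactorial k := by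
  have h1 : ((N + k).choose N : ℚ) = intFactorial (N + k) * invFactorial N * invFactorial k := by
    rw [choose_eq_factorials (by omega)]
    push_cast
    ring_nf
  have h2 : ((N + k).choose (N + 1) : ℚ) =
      intFactorial (N + k) * invFactorial (N + 1) * invFactorial (k - 1) := by
    rcases k with _ | k
    · simp [invFactorial_of_neg]
    · rw [choose_eq_factorials (by omega)]
      push_cast
      ring_nf
  unfold catT
  push_cast
  rw [h1, h2, invFactorial_eq_add_one_mul N, invFactorial_eq_add_one_mul (k - 1)]
  push_cast
  ring_nf

/-- The multinomial weight `(N - j)! / (j! (k - j)! (N - k - j)!)`. -/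
def weight (N j k : ℕ) : ℕ := (N - j).choose k * k.choose j

theorem choose_mul_weight {N j : ℕ} (hj : j ≤ N) (k : ℕ) :
    N.choose k * weight N j k =
      N.choose j * ∑ u ∈ Finset.range (N - j + 1), (N - j).choose u * weight N (j + u) k := by
  unfold weight
  by_cases hjk : j ≤ k
  · by_cases hkj : k ≤ N - j
    · have hterm : ∀ u ∈ Finset.range (N - j + 1),
          (N - j).choose u * ((N - (j + u)).choose k * k.choose (j + u)) =
            (N - j).choose k * ((N - j - k).choose u * k.choose (j + u)) := by
        intro u hu
        have hu := Finset.mem_range.mp hu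
        by_cases huk : u + k ≤ N - j
        · have h1 := Nat.choose_mul (n := N - j) (k := u + k) (s := u) (by omega)
          have h2 := Nat.choose_mul (n := N - j) (k := u + k) (s := k) (by omega)
          rw [Nat.add_sub_cancel_left] at h1
          rw [Nat.add_sub_cancel, ← Nat.choose_symm_add] at h2
          rw [← Nat.sub_sub, ← mul_assoc, ← mul_assoc, ← h1, ← h2]
        · rw [Nat.choose_eq_zero_of_lt (by omega : N - (j + u) < k),
            Nat.choose_eq_zero_of_lt (by omega : N - j - k < u)]
          ring
      have hvand : ∑ u ∈ Finset.range (N - j + 1), (N - j - k).choose u * k.choose (j + u) =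
          (N - j).choose (k - j) := by
        rw [← Finset.sum_subset (Finset.range_mono (by omega : k - j + 1 ≤ N - j + 1))]
        · conv_rhs => rw [show N - j = (N - j - k) + k by omega, Nat.add_choose_eq,
            Finset.Nat.sum_antidiagonal_eq_sum_range_succ_mk]
          refine Finset.sum_congr rfl fun u hu => ?_
          have hu := Finset.mem_range.mp hu
          rw [← Nat.choose_symm (by omega : j + u ≤ k), Nat.sub_sub k j u]
        · intro u _ hu
          rw [Finset.mem_range] at hu
          rw [Nat.choose_eq_zero_of_lt (by omega : k < j + u), mul_zero]
      rw [Finset.sum_congr rfl hterm, ← Finset.mul_sum, hvand]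
      have h := Nat.choose_mul (n := N) (k := k) (s := j) hjk
      linear_combination (N - j).choose k * h
    · rw [Nat.choose_eq_zero_of_lt (by omega : N - j < k), Finset.sum_eq_zero]
      · ring
      · intro u _
        rw [Nat.choose_eq_zero_of_lt (by omega : N - (j + u) < k)]
        ring
  · rw [Nat.choose_eq_zero_of_lt (by omega : k < j), Finset.sum_eq_zero]
    · ring
    · intro u _
      rw [Nat.choose_eq_zero_of_lt (by omega : k < j + u)]
      ring

/-- Divisibility of the weighted sums propagates to higher powers of the binomial coefficient. -/
theorem dvd_sum_weight_mul_choose_pow {N : ℕ} {q : ℤ} {F : ℕ → ℤ}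
    (h : ∀ j ≤ N, q ∣ ∑ k ∈ Finset.range (N + 1), (weight N j k : ℤ) * F k) (t : ℕ) :
    ∀ j ≤ N, q ∣ ∑ k ∈ Finset.range (N + 1), (weight N j k : ℤ) * (N.choose k : ℤ) ^ t * F k := by
  induction t with
  | zero => simpa using h
  | succ t ih =>
    intro j hj
    have hrec : ∑ k ∈ Finset.range (N + 1), (weight N j k : ℤ) * (N.choose k : ℤ) ^ (t + 1) * F k =
        N.choose j * ∑ u ∈ Finset.range (N - j + 1), ((N - j).choose u : ℤ) *
          ∑ k ∈ Finset.range (N + 1), (weight N (j + u) k : ℤ) * (N.choose k : ℤ) ^ t * F k := by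
      simp_rw [Finset.mul_sum]
      rw [Finset.sum_comm' (t' := Finset.range (N + 1))
        (s' := fun _ => Finset.range (N - j + 1)) (by intros; tauto)]
      refine Finset.sum_congr rfl fun k hk => ?_
      have hk := Finset.mem_range.mp hk
      have hw : (N.choose k : ℤ) * weight N j k = N.choose j *
          ∑ u ∈ Finset.range (N - j + 1), ((N - j).choose u : ℤ) * weight N (j + u) k := by
        exact_mod_cast choose_mul_weight hj k
      rw [Finset.mul_sum] at hw
      rw [pow_succ, show (weight N j k : ℤ) * ((N.choose k : ℤ) ^ t * N.choose k) * F k =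
        (N.choose k * weight N j k) * ((N.choose k : ℤ) ^ t * F k) by ring, hw, Finset.sum_mul]
      exact Finset.sum_congr rfl fun u _ => by ring
    rw [hrec]
    refine Dvd.dvd.mul_left (Finset.dvd_sum fun u hu => ?_) _
    have hu := Finset.mem_range.mp hu
    exact Dvd.dvd.mul_left (ih (j + u) (by omega)) _

theorem weight_eq_factorials {N j : ℕ} (hj : j ≤ N) (k : ℕ) :
    (weight N j k : ℚ) =
      intFactorial (N - j) * invFactorial j * invFactorial (k - j) * invFactorial (N - j - k) := by
  unfold weight
  by_cases hjk : j ≤ k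
  · by_cases hkj : k ≤ N - j
    · rw [Nat.cast_mul, choose_eq_factorials hkj, choose_eq_factorials hjk, Nat.cast_sub hj]
      have h := intFactorial_mul_invFactorial (z := (k : ℤ)) (by omega)
      linear_combination intFactorial ((N : ℤ) - j) * invFactorial j * invFactorial (k - j) *
        invFactorial (N - j - k) * h
    · rw [Nat.choose_eq_zero_of_lt (by omega : N - j < k),
        invFactorial_of_neg (by omega : (N : ℤ) - j - k < 0)]
      simp
  · rw [Nat.choose_eq_zero_of_lt (by omega : k < j),
      invFactorial_of_neg (by omega : (k : ℤ) - j < 0)]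
    simp

theorem weight_mul_catT_eq {n j k : ℕ} (hj : j ≤ n) (hk : k ≤ 2 * n) :
    (weight (2 * n) j k : ℚ) * ((-1) ^ k * catT (2 * n) k * catT (2 * n) (2 * n - k)) =
      intFactorial (2 * n - j) * invFactorial j * invFactorial (2 * n + 1) ^ 2 *
        ((-1) ^ k * dixonTerm (n - j) (n - 1) (3 * n) (k - n) +
          (2 * n + 1) * ((-1) ^ k * dixonTerm (n - j) n (3 * n) (k - n))) := by
  have e1 := invFactorial_eq_add_one_mul ((k : ℤ) - 1)
  have e2 := invFactorial_eq_add_one_mul (2 * n - k - 1)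
  rw [weight_eq_factorials (by omega) k, catT_eq, catT_eq]
  unfold dixonTerm
  rw [Nat.cast_sub hk, Nat.cast_sub hk]
  push_cast
  rw [show (3 * n + (k - n) : ℤ) = 2 * n + k by ring,
    show (3 * n - (k - n) : ℤ) = 2 * n + (2 * n - k) by ring,
    show (n - j + (k - n) : ℤ) = k - j by ring,
    show (n - j - (k - n) : ℤ) = 2 * n - j - k by ring,
    show (n - 1 + (k - n) : ℤ) = k - 1 by ring,
    show (n - 1 - (k - n) : ℤ) = 2 * n - k - 1 by ring,
    show (n + (k - n) : ℤ) = k by ring, show (n - (k - n) : ℤ) = 2 * n - k by ring,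
    e1, e2, show (k - 1 + 1 : ℤ) = k by ring, show (2 * n - k - 1 + 1 : ℤ) = 2 * n - k by ring]
  push_cast
  ring

theorem exists_int_eq_mul_factorials {n j : ℕ} (hj : j ≤ n) :
    ∃ w : ℤ, (w : ℚ) = n * (intFactorial (2 * n + j) * invFactorial j * invFactorial (n - j) *
      invFactorial (n + j + 1)) := by
  have h1 : ∃ w : ℤ, (w : ℚ) = (n - j) * (intFactorial (2 * n + j) * invFactorial j *
      invFactorial (n - j) * invFactorial (n + j + 1)) := by
    rcases hj.eq_or_lt with rfl | hjn
    · exact ⟨0, by simp⟩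
    · refine ⟨(2 * n + j).choose j * (2 * n).choose (n - j - 1), ?_⟩
      have e := invFactorial_eq_add_one_mul ((n : ℤ) - j - 1)
      have h := intFactorial_mul_invFactorial (z := 2 * (n : ℤ)) (by omega)
      push_cast
      rw [choose_eq_factorials (by omega), choose_eq_factorials (by omega), Nat.sub_sub,
        Nat.cast_sub (by omega : j + 1 ≤ n)]
      push_cast
      rw [show (2 * n + j - j : ℤ) = 2 * n by ring, show (n - (j + 1) : ℤ) = n - j - 1 by ring,
        show (2 * n - (n - j - 1) : ℤ) = n + j + 1 by ring, e,
        show (n - j - 1 + 1 : ℤ) = n - j by ring]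
      push_cast
      linear_combination (n - j) * (intFactorial (2 * n + j) * invFactorial j *
        invFactorial (n - j) * invFactorial (n + j + 1)) * h
  have h2 : ∃ w : ℤ, (w : ℚ) = j * (intFactorial (2 * n + j) * invFactorial j *
      invFactorial (n - j) * invFactorial (n + j + 1)) := by
    rcases j with _ | j
    · exact ⟨0, by simp⟩
    · refine ⟨(2 * n + (j + 1)).choose j * (2 * n + 1).choose (n - (j + 1)), ?_⟩
      have e := invFactorial_eq_add_one_mul j
      have h := intFactorial_mul_invFactorial (z := 2 * (n : ℤ) + 1) (by omega)
      push_cast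
      rw [choose_eq_factorials (by omega), choose_eq_factorials (by omega), Nat.cast_sub hj]
      push_cast
      rw [show (2 * n + (j + 1) - j : ℤ) = 2 * n + 1 by ring,
        show (2 * n + 1 - (n - (j + 1)) : ℤ) = n + (j + 1) + 1 by ring, e]
      push_cast
      linear_combination (j + 1) * (intFactorial (2 * n + (j + 1)) * invFactorial (j + 1) *
        invFactorial (n - (j + 1)) * invFactorial (n + (j + 1) + 1)) * h
  obtain ⟨w₁, hw₁⟩ := h1
  obtain ⟨w₂, hw₂⟩ := h2
  refine ⟨w₁ + w₂, ?_⟩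
  push_cast
  rw [hw₁, hw₂]
  ring

theorem choose_dvd_sum_weight_mul_catT {n j : ℕ} (hn : 1 ≤ n) (hj : j ≤ n) :
    ((3 * n).choose n : ℤ) ∣ ∑ k ∈ Finset.range (2 * n + 1), (weight (2 * n) j k : ℤ) *
      ((2 * n + 1) * ((-1) ^ k * catT (2 * n) k * catT (2 * n) (2 * n - k))) := by
  obtain ⟨w, hw⟩ := exists_int_eq_mul_factorials hj
  refine ⟨(-1) ^ n * ((2 * n - j) * w + (2 * n + j).choose j * (2 * n).choose (n - j)), ?_⟩
  have d1 := sum_dixonTerm (a := n - j) (R := n) (c := n - 1) (d := 3 * n)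
    (by omega) (by omega) (by omega)
  have d2 := sum_dixonTerm (a := n - j) (R := n) (c := n) (d := 3 * n)
    (by omega) (by omega) (by omega)
  push_cast [Nat.cast_sub hj, Nat.cast_sub hn] at d1 d2
  have hsum : ∑ k ∈ Finset.range (2 * n + 1), (weight (2 * n) j k : ℚ) *
      ((2 * n + 1) * ((-1) ^ k * catT (2 * n) k * catT (2 * n) (2 * n - k))) =
      (2 * n + 1) * (intFactorial (2 * n - j) * invFactorial j * invFactorial (2 * n + 1) ^ 2 *
        (∑ k ∈ Finset.range (2 * n + 1),
            (-1) ^ k * dixonTerm (n - j) (n - 1) (3 * n) (k - n) +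
          (2 * n + 1) * ∑ k ∈ Finset.range (2 * n + 1),
            (-1) ^ k * dixonTerm (n - j) n (3 * n) (k - n))) := by
    rw [Finset.mul_sum, ← Finset.sum_add_distrib, Finset.mul_sum, Finset.mul_sum]
    refine Finset.sum_congr rfl fun k hk => ?_
    have hk := Finset.mem_range.mp hk
    rw [← weight_mul_catT_eq hj (by omega)]
    ring
  have e1 := invFactorial_eq_add_one_mul ((n : ℤ) - 1)
  have e2 := invFactorial_eq_add_one_mul (2 * (n : ℤ) - j - 1)
  have e3 := invFactorial_eq_add_one_mul (2 * (n : ℤ))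
  have e4 := intFactorial_add_one (z := 2 * (n : ℤ)) (by omega)
  have m1 := intFactorial_mul_invFactorial (z := 2 * (n : ℤ) - j) (by omega)
  have m2 := intFactorial_mul_invFactorial (z := 2 * (n : ℤ) + 1) (by omega)
  rw [show (n - 1 + 1 : ℤ) = n by ring] at e1
  rw [show (2 * n - j - 1 + 1 : ℤ) = 2 * n - j by ring] at e2
  rw [← Int.cast_inj (α := ℚ)]
  push_cast
  rw [hsum, d1, d2, hw, choose_eq_factorials (by omega), choose_eq_factorials (by omega),
    choose_eq_factorials (by omega), Nat.cast_sub hj]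
  push_cast
  rw [show (3 * n - (n - 1) : ℤ) = 2 * n + 1 by ring,
    show (3 * n - (n - j) : ℤ) = 2 * n + j by ring,
    show (n - j + (n - 1) : ℤ) = 2 * n - j - 1 by ring,
    show (2 * n + 1 - (n - j) : ℤ) = n + j + 1 by ring,
    show (3 * n - n : ℤ) = 2 * n by ring,
    show (n - j + n : ℤ) = 2 * n - j by ring,
    show (2 * n - (n - j) : ℤ) = n + j by ring,
    show (2 * n + j - j : ℤ) = 2 * n by ring, e1, e2, e3, e4]
  rw [e4] at m2
  push_cast at m2 ⊢
  linear_combination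
    (-1) ^ n * intFactorial (3 * n) * invFactorial n * (2 * n + 1) * invFactorial (2 * n + 1) *
        intFactorial (2 * n + j) * invFactorial j * invFactorial (n - j) *
      ((2 * n - j) * n * invFactorial (n + j + 1) *
          ((2 * n + 1) * intFactorial (2 * n) * invFactorial (2 * n + 1) * m1 + m2) +
        (2 * n + 1) * invFactorial (2 * n + 1) * intFactorial (2 * n) * invFactorial (n + j) * m1)

theorem stmt1 (n m : ℕ) (hm : 1 ≤ m) :
    (((3 * n).choose n : ℤ)) ∣ (2 * (n : ℤ) + 1) * S n m := by
  rcases Nat.eq_zero_or_pos n with rfl | hn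
  · simp
  obtain ⟨t, rfl⟩ := Nat.exists_eq_add_of_le' hm
  have h := dvd_sum_weight_mul_choose_pow (N := 2 * n) (q := ((3 * n).choose n : ℤ))
    (F := fun k => (2 * n + 1) * ((-1) ^ k * catT (2 * n) k * catT (2 * n) (2 * n - k)))
    (fun j _ => by
      by_cases hjn : j ≤ n
      · exact choose_dvd_sum_weight_mul_catT hn hjn
      · rw [Finset.sum_eq_zero]
        · exact dvd_zero _
        · intro k _
          have : weight (2 * n) j k = 0 := by
            unfold weight
            rcases lt_or_ge k j with h | h
            · rw [Nat.choose_eq_zero_of_lt h, mul_zero]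
            · rw [Nat.choose_eq_zero_of_lt (by omega : 2 * n - j < k), zero_mul]
          rw [this, Nat.cast_zero, zero_mul]) t 0 (by omega)
  convert h using 1
  unfold S
  rw [Finset.mul_sum]
  refine Finset.sum_congr rfl fun k _ => ?_
  simp only [weight, Nat.sub_zero, Nat.choose_zero_right, mul_one]
  ring
end

section
/- For every non-negative integer n and every non-negative integer j with j ≤ n, (2n+1)^2 * M_S(2n,j,0) = (-1)^n * binom(3n,n) * binom(2n+j,j) * binom(2n+1,n+j+1) * (2n^2+n+1-j*(n-1)); equivalently, M_S(2n,j,0) = (-1)^n * C3(n) * T(n,j) * (2n^2+n+1-j*(n-1)), where C3(n) = binom(3n,n)/(2n+1) and T(n,j) = binom(2n+j,j)*binom(2n+1,n+j+1)/(2n+1). -/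
/-- `F(2n,k) = (-1)^k C(2n,k) C(2n,2n-k)`. -/
def F (n k : ℕ) : ℤ := (-1) ^ k * catT (2 * n) k * catT (2 * n) (2 * n - k)

/-- The M sum
`M_S(2n,j,t) = binom(2n-j,j) * Σ_{v=0}^{2n-2j} binom(2n-2j,v) binom(2n,j+v)^t F(2n,j+v)`. -/
def MS (n j t : ℕ) : ℤ :=
  ((2 * n - j).choose j : ℤ) *
    ∑ v ∈ Finset.range (2 * n - 2 * j + 1),
      ((2 * n - 2 * j).choose v : ℤ) * ((2 * n).choose (j + v) : ℤ) ^ t * F n (j + v)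

/-- The coefficients `(b)_v (c)_v / v!` of the series `₂F₀(b, c; x)`. -/
noncomputable def hypCoeff {K : Type*} [Field K] (b c : K) (v : ℕ) : K :=
  (ascPochhammer K v).eval b * (ascPochhammer K v).eval c / (v.factorial : K)

section Pochhammer

variable {K : Type*} [Field K]

theorem ascPochhammer_eval_mul_add (x : K) (v : ℕ) :
    (ascPochhammer K v).eval x * (x + v) = x * (ascPochhammer K v).eval (x + 1) := by
  rw [← ascPochhammer_succ_eval, ascPochhammer_succ_left]
  simp

theorem ascPochhammer_eval_natCast_add_one (p v : ℕ) :
    (ascPochhammer K v).eval ((p : K) + 1) * (p.factorial : K) = ((p + v).factorial : K) := by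
  induction v with
  | zero => simp
  | succ v ih =>
    rw [ascPochhammer_succ_eval, ← add_assoc p v 1, Nat.factorial_succ]
    push_cast
    rw [← ih]
    ring

theorem ascPochhammer_eval_neg_natCast_add (q v : ℕ) :
    (ascPochhammer K v).eval (-((q : K) + v)) * (q.factorial : K) =
      (-1) ^ v * ((q + v).factorial : K) := by
  induction v generalizing q with
  | zero => simp
  | succ v ih =>
    have h := ih (q + 1)
    rw [Nat.factorial_succ] at h
    rw [ascPochhammer_succ_eval, show q + (v + 1) = q + 1 + v by ring, pow_succ,
      mul_right_comm _ (-1 : K), ← h]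
    push_cast
    rw [show (q : K) + (v + 1) = q + 1 + v by ring]
    ring

theorem hypCoeff_succ [CharZero K] (b c : K) (v : ℕ) :
    hypCoeff b c (v + 1) * (v + 1) = (b + v) * (c + v) * hypCoeff b c v := by
  have h1 : (v.factorial : K) ≠ 0 := Nat.cast_ne_zero.2 v.factorial_ne_zero
  have h2 : (v : K) + 1 ≠ 0 := Nat.cast_add_one_ne_zero v
  simp only [hypCoeff, ascPochhammer_succ_eval, Nat.factorial_succ]
  push_cast
  field_simp

theorem hypCoeff_mul_add (b c : K) (v : ℕ) :
    hypCoeff b c v * (c + v) = c * hypCoeff b (c + 1) v := by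
  have h := ascPochhammer_eval_mul_add c v
  simp only [hypCoeff]
  linear_combination (ascPochhammer K v).eval b / (v.factorial : K) * h

end Pochhammer

section Dixon

variable {K : Type*} [Field K] [CharZero K]

/-- The alternating self-convolution of `hypCoeff` at `2 * N`. -/
noncomputable def dixonSum (b c : K) (N : ℕ) : K :=
  ∑ v ∈ Finset.range (2 * N + 1), (-1) ^ v * (hypCoeff b c v * hypCoeff b c (2 * N - v))

/-- The telescoped form of the recurrence for `dixonSum`. -/
theorem dixonSum_partial (b c : K) (N k : ℕ) (hk : k ≤ 2 * N + 1) :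
    2 * ((N + 1) * (b + c + N) * ∑ v ∈ Finset.range (k + 1),
        (-1) ^ v * (hypCoeff b c v * hypCoeff b c (2 * (N + 1) - v)) -
      (b + N) * (c + N) * (b + c + 2 * N) * (b + c + 2 * N + 1) *
        ∑ v ∈ Finset.range k, (-1) ^ v * (hypCoeff b c v * hypCoeff b c (2 * N - v))) =
      (-1) ^ k * ((b + c + N) * (b + 2 * N + 1) * (c + 2 * N + 1) - 2 * (N + 1) ^ 2 +
        (N + 1) * (k + 1) * (2 * N + 2 - k)) *
        (hypCoeff b c k * hypCoeff b c (2 * N + 1 - k)) := by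
  induction k with
  | zero =>
    have h := hypCoeff_succ b c (2 * N + 1)
    simp only [zero_add, Finset.sum_range_one, Finset.sum_range_zero, pow_zero, Nat.sub_zero,
      mul_zero, sub_zero, Nat.cast_zero]
    push_cast at h
    rw [show 2 * (N + 1) = 2 * N + 1 + 1 by ring]
    linear_combination hypCoeff b c 0 * (b + c + N) * h
  | succ k ih =>
    obtain ⟨w, hw⟩ : ∃ w, 2 * N = k + w := ⟨2 * N - k, by omega⟩
    have hN : 2 * (N : K) = k + w := by exact_mod_cast hw
    have ih := ih (by omega)
    rw [show 2 * N + 1 - k = w + 1 by omega] at ih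
    rw [Finset.sum_range_succ _ (k + 1), Finset.sum_range_succ (fun v => _ * (_ * hypCoeff b c (2 * N - v))) k,
      show 2 * (N + 1) - (k + 1) = w + 1 by omega, show 2 * N - k = w by omega,
      show 2 * N + 1 - (k + 1) = w by omega]
    have hk0 : (k : K) + 1 ≠ 0 := Nat.cast_add_one_ne_zero k
    have hw0 : (w : K) + 1 ≠ 0 := Nat.cast_add_one_ne_zero w
    obtain ⟨x, hx⟩ : ∃ x, hypCoeff b c k = x * (k + 1) := ⟨_, (div_mul_cancel₀ _ hk0).symm⟩
    obtain ⟨y, hy⟩ : ∃ y, hypCoeff b c w = y * (w + 1) := ⟨_, (div_mul_cancel₀ _ hw0).symm⟩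
    have hx' : hypCoeff b c (k + 1) = (b + k) * (c + k) * x := by
      apply mul_right_cancel₀ hk0
      rw [hypCoeff_succ, hx]
      ring
    have hy' : hypCoeff b c (w + 1) = (b + w) * (c + w) * y := by
      apply mul_right_cancel₀ hw0
      rw [hypCoeff_succ, hy]
      ring
    have hN' : (w : K) = 2 * N - k := by rw [hN]; ring
    rw [hx, hy'] at ih
    rw [hx, hx', hy, hy', pow_succ]
    push_cast
    rw [hN'] at ih ⊢
    linear_combination ih

theorem dixonSum_succ (b c : K) (N : ℕ) :
    (N + 1) * (b + c + N) * dixonSum b c (N + 1) =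
      (b + N) * (c + N) * (b + c + 2 * N) * (b + c + 2 * N + 1) * dixonSum b c N := by
  have h := dixonSum_partial b c N (2 * N + 1) le_rfl
  have hs := hypCoeff_succ b c (2 * N + 1)
  have hp : (-1 : K) ^ (2 * N + 1) = -1 := Odd.neg_one_pow ⟨N, rfl⟩
  have hp' : (-1 : K) ^ (2 * N + 1 + 1) = 1 := by rw [pow_succ, hp]; ring
  rw [hp, Nat.sub_self] at h
  unfold dixonSum
  rw [show 2 * (N + 1) + 1 = 2 * N + 1 + 1 + 1 by ring, Finset.sum_range_succ _ (2 * N + 1 + 1), hp',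
    show 2 * (N + 1) - (2 * N + 1 + 1) = 0 by omega]
  push_cast at h hs
  linear_combination h / 2 + hypCoeff b c 0 * (b + c + N) / 2 * hs

/-- Dixon's summation of a terminating well-poised `₃F₂(1)`. -/
theorem dixonSum_eq (b c : K) (hbc : ∀ i : ℕ, b + c + i ≠ 0) (N : ℕ) :
    (N.factorial : K) * dixonSum b c N =
      (ascPochhammer K N).eval b * (ascPochhammer K N).eval c *
        (ascPochhammer K N).eval (b + c + N) := by
  induction N with
  | zero => simp [dixonSum, hypCoeff]
  | succ N ih =>
    have h := dixonSum_succ b c N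
    have hp := ascPochhammer_eval_mul_add (b + c + N) N
    apply mul_left_cancel₀ (hbc N)
    rw [Nat.factorial_succ, ascPochhammer_succ_eval, ascPochhammer_succ_eval,
      ascPochhammer_succ_eval]
    push_cast
    rw [show b + c + ((N : K) + 1) = b + c + N + 1 by ring]
    linear_combination (N.factorial : K) * h +
      (b + N) * (c + N) * (b + c + 2 * N) * (b + c + 2 * N + 1) * ih +
      (b + N) * (c + N) * (b + c + 2 * N + 1) *
        (ascPochhammer K N).eval b * (ascPochhammer K N).eval c * hp

/-- A contiguous form of Dixon's summation. -/
theorem dixonSum_weighted (b c d : K) (hbc : ∀ i : ℕ, b + c + i ≠ 0) (N : ℕ) :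
    (b + c + N) * (N.factorial : K) *
      ∑ v ∈ Finset.range (2 * N + 1), (-1) ^ v * (hypCoeff b c v * hypCoeff b c (2 * N - v) *
        ((c + v) * (c + (2 * N - v : ℕ)) + d)) =
      (ascPochhammer K N).eval b * (ascPochhammer K N).eval c *
        (ascPochhammer K N).eval (b + c + N) *
        (c * (c + N) * (b + c + 2 * N) + d * (b + c + N)) := by
  have hsum : ∑ v ∈ Finset.range (2 * N + 1), (-1) ^ v *
      (hypCoeff b c v * hypCoeff b c (2 * N - v) * ((c + v) * (c + (2 * N - v : ℕ)) + d)) =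
      c ^ 2 * dixonSum b (c + 1) N + d * dixonSum b c N := by
    unfold dixonSum
    rw [Finset.mul_sum, Finset.mul_sum, ← Finset.sum_add_distrib]
    refine Finset.sum_congr rfl fun v _ => ?_
    have h1 := hypCoeff_mul_add b c v
    have h2 := hypCoeff_mul_add b c (2 * N - v)
    linear_combination (-1) ^ v * (hypCoeff b c (2 * N - v) * (c + (2 * N - v : ℕ))) * h1 +
      (-1) ^ v * c * hypCoeff b (c + 1) v * h2
  have h1 := dixonSum_eq b c hbc N
  have h2 := dixonSum_eq b (c + 1) (fun i => by
    have := hbc (i + 1)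
    push_cast at this
    rwa [show b + (c + 1) + (i : K) = b + c + (i + 1) by ring]) N
  have h3 := ascPochhammer_eval_mul_add c N
  have h4 := ascPochhammer_eval_mul_add (b + c + N) N
  rw [show b + (c + 1) + (N : K) = b + c + N + 1 by ring] at h2
  rw [hsum]
  linear_combination (b + c + N) * d * h1 + (b + c + N) * c ^ 2 * h2 -
    (b + c + N) * c * (ascPochhammer K N).eval b *
      (ascPochhammer K N).eval (b + c + N + 1) * h3 -
    c * (c + N) * (ascPochhammer K N).eval b * (ascPochhammer K N).eval c * h4

end Dixon

theorem catT_mul (N k : ℕ) :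
    ((N : ℚ) + 1) * catT N k * (N.factorial * k.factorial) =
      (N + 1 - k) * ((N + k).factorial : ℚ) := by
  have h1 : ((N + k).choose (N + 1) : ℚ) * (N + 1) = (N + k).choose N * k := by
    have := Nat.choose_succ_right_eq (N + k) N
    rw [Nat.add_sub_cancel_left] at this
    exact_mod_cast this
  have h2 : ((N + k).choose N : ℚ) * N.factorial * k.factorial = (N + k).factorial := by
    exact_mod_cast Nat.choose_symm_add (a := N) (b := k) ▸ Nat.add_choose_mul_factorial_mul_factorial N k
  unfold catT
  push_cast
  linear_combination (-(N.factorial : ℚ) * k.factorial) * h1 + ((N : ℚ) + 1 - k) * h2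

/-- The summand of `MS n j 0`, for `n = j + N` and `v + w = 2 * N`, in terms of `hypCoeff`. -/
theorem choose_mul_F_eq (j N v w : ℕ) (h : v + w = 2 * N) :
    (2 * ((j + N : ℕ) : ℚ) + 1) ^ 2 * (((2 * N).choose v : ℚ) * F (j + N) (j + v)) *
        ((2 * (j + N)).factorial ^ 2 * (j + 2 * N).factorial ^ 2) =
      (-1) ^ j * ((2 * N).factorial * (2 * (j + N) + j).factorial ^ 2) *
        ((-1) ^ v * (hypCoeff (((2 * (j + N) + j : ℕ) : ℚ) + 1) (-((j : ℚ) + 2 * N)) v *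
          hypCoeff (((2 * (j + N) + j : ℕ) : ℚ) + 1) (-((j : ℚ) + 2 * N)) w *
          ((-((j : ℚ) + 2 * N) + v) * (-((j : ℚ) + 2 * N) + w) +
            (2 * ((j + N : ℕ) : ℚ) + 1)))) := by
  have hq : (2 : ℚ) * N = v + w := by exact_mod_cast h.symm
  have e : 2 * (j + N) - (j + v) = j + w := by omega
  have c1 := catT_mul (2 * (j + N)) (j + v)
  have c2 := catT_mul (2 * (j + N)) (j + w)
  have p1 := ascPochhammer_eval_natCast_add_one (K := ℚ) (2 * (j + N) + j) v
  have p2 := ascPochhammer_eval_natCast_add_one (K := ℚ) (2 * (j + N) + j) w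
  have q1 := ascPochhammer_eval_neg_natCast_add (K := ℚ) (j + w) v
  have q2 := ascPochhammer_eval_neg_natCast_add (K := ℚ) (j + v) w
  have hb : ((2 * N).choose v : ℚ) * v.factorial * w.factorial = (2 * N).factorial := by
    rw [← h]
    exact_mod_cast Nat.choose_symm_add (a := v) (b := w) ▸
      Nat.add_choose_mul_factorial_mul_factorial v w
  have hs : (-1 : ℚ) ^ v * (-1) ^ w = 1 := by
    rw [← pow_add, h]
    exact Even.neg_one_pow ⟨N, by ring⟩
  rw [show j + w + v = j + 2 * N by omega,
    show -(((j + w : ℕ) : ℚ) + v) = -((j : ℚ) + 2 * N) by rw [hq]; push_cast; ring] at q1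
  rw [show j + v + w = j + 2 * N by omega,
    show -(((j + v : ℕ) : ℚ) + w) = -((j : ℚ) + 2 * N) by rw [hq]; push_cast; ring] at q2
  have f0 (i : ℕ) : (i.factorial : ℚ) ≠ 0 := Nat.cast_ne_zero.2 i.factorial_ne_zero
  rw [← eq_div_iff (mul_ne_zero (f0 _) (f0 _))] at c1 c2
  rw [← eq_div_iff (f0 _)] at p1 p2 q1 q2
  rw [mul_assoc, ← eq_div_iff (mul_ne_zero (f0 _) (f0 _))] at hb
  unfold F hypCoeff
  rw [e, p1, p2, q1, q2, hb]
  push_cast at c1 c2 ⊢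
  rw [show ∀ x y z u : ℚ, (2 * ((j : ℚ) + N) + 1) ^ 2 * (x * (y * z * u)) =
    x * y * (((2 * ((j : ℚ) + N) + 1) * z) * ((2 * ((j : ℚ) + N) + 1) * u)) by intros; ring, c1, c2,
    show 2 * (j + N) + (j + v) = 2 * (j + N) + j + v by ring,
    show 2 * (j + N) + (j + w) = 2 * (j + N) + j + w by ring, pow_add,
    show (2 : ℚ) * (j + N) = 2 * j + (v + w) by rw [← hq]; ring, hq]
  field_simp
  linear_combination (-(1 + 2 * (j : ℚ) + v + w + (j + v) * (j + w))) * hs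

theorem stmt5 (n j : ℕ) (hj : j ≤ n) :
    (2 * (n : ℤ) + 1) ^ 2 * MS n j 0 =
      (-1) ^ n * ((3 * n).choose n : ℤ) * ((2 * n + j).choose j : ℤ) *
        ((2 * n + 1).choose (n + j + 1) : ℤ) *
        (2 * (n : ℤ) ^ 2 + n + 1 - j * ((n : ℤ) - 1)) := by
  obtain ⟨N, rfl⟩ := Nat.exists_eq_add_of_le hj
  have f0 (i : ℕ) : (i.factorial : ℚ) ≠ 0 := Nat.cast_ne_zero.2 i.factorial_ne_zero
  have hfac {a b c : ℕ} (h : a = b + c) :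
      (a.choose b : ℚ) = a.factorial / (b.factorial * c.factorial) := by
    subst h
    rw [eq_div_iff (mul_ne_zero (f0 _) (f0 _)), ← mul_assoc, Nat.choose_symm_add]
    exact_mod_cast Nat.add_choose_mul_factorial_mul_factorial b c
  have hD := dixonSum_weighted (((2 * (j + N) + j : ℕ) : ℚ) + 1) (-((j : ℚ) + 2 * N))
    (2 * ((j + N : ℕ) : ℚ) + 1) (fun i => by
      push_cast
      rw [show (2 * ((j : ℚ) + N) + j + 1 + -(j + 2 * N) + i) = 2 * j + i + 1 by ring]
      positivity) N
  have hM : (2 * ((j + N : ℕ) : ℚ) + 1) ^ 2 * (MS (j + N) j 0 : ℚ) *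
      ((2 * (j + N)).factorial ^ 2 * (j + 2 * N).factorial ^ 2) =
      ((j + 2 * N).choose j : ℚ) *
        ((-1) ^ j * ((2 * N).factorial * (2 * (j + N) + j).factorial ^ 2) *
        ∑ v ∈ Finset.range (2 * N + 1), (-1) ^ v *
          (hypCoeff (((2 * (j + N) + j : ℕ) : ℚ) + 1) (-((j : ℚ) + 2 * N)) v *
          hypCoeff (((2 * (j + N) + j : ℕ) : ℚ) + 1) (-((j : ℚ) + 2 * N)) (2 * N - v) *
          ((-((j : ℚ) + 2 * N) + v) * (-((j : ℚ) + 2 * N) + (2 * N - v : ℕ)) +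
            (2 * ((j + N : ℕ) : ℚ) + 1)))) := by
    unfold MS
    rw [show 2 * (j + N) - j = j + 2 * N by omega, show 2 * (j + N) - 2 * j = 2 * N by omega,
      Finset.mul_sum (Finset.range (2 * N + 1)) _ ((-1 : ℚ) ^ j * _)]
    rw [← Finset.sum_congr rfl fun v hv => choose_mul_F_eq j N v (2 * N - v)
      (by have := Finset.mem_range.1 hv; omega), ← Finset.sum_mul, ← Finset.mul_sum]
    push_cast
    simp only [pow_zero, mul_one]
    ring
  have p1 := ascPochhammer_eval_natCast_add_one (K := ℚ) (2 * (j + N) + j) N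
  have p2 := ascPochhammer_eval_neg_natCast_add (K := ℚ) (j + N) N
  have p3 := ascPochhammer_eval_natCast_add_one (K := ℚ) (2 * j + N) N
  rw [show -(((j + N : ℕ) : ℚ) + N) = -((j : ℚ) + 2 * N) by push_cast; ring,
    show j + N + N = j + 2 * N by ring] at p2
  rw [show (((2 * j + N : ℕ) : ℚ) + 1) =
      ((2 * (j + N) + j : ℕ) : ℚ) + 1 + -((j : ℚ) + 2 * N) + N by push_cast; ring,
    show 2 * j + N + N = 2 * (j + N) by ring] at p3
  rw [show 2 * (j + N) + j + N = 3 * (j + N) by ring] at p1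
  rw [← eq_div_iff (f0 _)] at p1 p2 p3
  have hb : ((2 * (j + N) + j : ℕ) : ℚ) + 1 + -((j : ℚ) + 2 * N) + N = 2 * j + N + 1 := by
    push_cast; ring
  have hb0 : (2 * (j : ℚ) + N + 1) ≠ 0 := by positivity
  rw [p1, p2, p3, hb, mul_comm, ← eq_div_iff (mul_ne_zero hb0 (f0 _))] at hD
  rw [hD, ← eq_div_iff (by simp [f0])] at hM
  have hQ : (2 * ((j + N : ℕ) : ℚ) + 1) ^ 2 * (MS (j + N) j 0 : ℚ) =
      (-1) ^ (j + N) * ((3 * (j + N)).choose (j + N) : ℚ) * ((2 * (j + N) + j).choose j : ℚ) *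
        ((2 * (j + N) + 1).choose (j + N + j + 1) : ℚ) *
        (2 * ((j + N : ℕ) : ℚ) ^ 2 + (j + N : ℕ) + 1 - j * (((j + N : ℕ) : ℚ) - 1)) := by
    rw [hM, hfac (show j + 2 * N = j + 2 * N from rfl),
      hfac (show 3 * (j + N) = (j + N) + 2 * (j + N) by ring),
      hfac (show 2 * (j + N) + j = j + 2 * (j + N) by ring),
      hfac (show 2 * (j + N) + 1 = (j + N + j + 1) + N by ring),
      show j + N + j + 1 = 2 * j + N + 1 by ring, Nat.factorial_succ (2 * (j + N)),
      Nat.factorial_succ (2 * j + N), pow_add]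
    push_cast
    field_simp
    ring
  exact_mod_cast hQ
end

section
/- For every non-negative integer n, the product (n+1)*(2n+1) divides (2n^2+n+1) * binom(3n,n); that is, ((2n^2+n+1)/((n+1)*(2n+1))) * binom(3n,n) is an integer. -/
theorem two_mul_add_one_dvd_choose_three_mul (n : ℕ) : 2 * n + 1 ∣ (3 * n).choose n := by
  cases n with
  | zero => simp
  | succ m =>
    have h := Nat.choose_succ_right_eq (3 * (m + 1)) m
    rw [show 3 * (m + 1) - m = 2 * (m + 1) + 1 by omega] at h
    have hc : Nat.Coprime (2 * (m + 1) + 1) (m + 1) := by simp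
    exact hc.dvd_of_dvd_mul_right (h ▸ Dvd.intro_left _ rfl)

theorem add_one_dvd_two_mul_choose_three_mul (n : ℕ) : n + 1 ∣ 2 * (3 * n).choose n := by
  have h := Nat.choose_succ_right_eq (3 * n) n
  rw [show 3 * n - n = 2 * n by omega] at h
  have hc : Nat.Coprime (n + 1) n := by simp
  refine hc.dvd_of_dvd_mul_right ⟨(3 * n).choose (n + 1), ?_⟩
  linarith

theorem stmt12 (n : ℕ) :
    (n + 1) * (2 * n + 1) ∣ (2 * n ^ 2 + n + 1) * (3 * n).choose n := by
  have hc : Nat.Coprime (n + 1) (2 * n + 1) := by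
    rw [show 2 * n + 1 = n + (n + 1) by ring]
    simp
  refine hc.mul_dvd_of_dvd_of_dvd ?_
    ((two_mul_add_one_dvd_choose_three_mul n).mul_left _)
  have h : (2 * n ^ 2 + n + 1) * (3 * n).choose n + (n + 1) * (3 * n).choose n
      = (n + 1) * (2 * n * (3 * n).choose n) + 2 * (3 * n).choose n := by ring
  rw [← Nat.dvd_add_left (Dvd.intro ((3 * n).choose n) rfl), h]
  exact dvd_add (Dvd.intro _ rfl) (add_one_dvd_two_mul_choose_three_mul n)
end

section
/- For all non-negative integers n, j and t with j ≤ t ≤ n, the product (2n+1)*(n+t+1) divides binom(3n,n+t) * binom(2n+t,t) * binom(n,t) * binom(t,j) * (2n^2+n+1-t*(n-1)); equivalently, the number N(n,j,t) = ((-1)^n/(2n+1)) * binom(3n,n+t) * binom(2n+t,t) * binom(n,t) * binom(t,j) * (2n^2+n+1-t*(n-1))/(n+t+1) is an integer. -/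
/-- `C(m + t, t) * t` is divisible by `m + 1`. -/
theorem succ_dvd_choose_add_mul (m t : ℕ) : m + 1 ∣ (m + t).choose t * t := by
  cases t with
  | zero => simp
  | succ k =>
    rw [Nat.choose_succ_right_eq, show m + (k + 1) - k = m + 1 by omega]
    exact Dvd.intro_left _ rfl

theorem succ_sub_dvd_choose_mul (m k : ℕ) (hk : k ≤ m) :
    m + 1 - k ∣ m.choose k * k := by
  obtain ⟨d, rfl⟩ := Nat.exists_eq_add_of_le' hk
  simpa [show d + k + 1 - k = d + 1 by omega] using succ_dvd_choose_add_mul d k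

theorem gcd_dvd_choose_three_mul (n t : ℕ) (htn : t ≤ n) :
    Nat.gcd t (2 * n + 1) ∣ (3 * n).choose (n + t) := by
  set g := Nat.gcd t (2 * n + 1) with hg
  have hgt : g ∣ t := Nat.gcd_dvd_left _ _
  have hgn : g ∣ 2 * n + 1 := Nat.gcd_dvd_right _ _
  have hcop : Nat.Coprime g (n + t) := by
    have h : Nat.Coprime (2 * n + 1) n := by simp
    obtain ⟨c, hc⟩ := hgt
    have := h.coprime_dvd_left hgn
    rw [hc]
    simpa using this
  refine hcop.dvd_of_dvd_mul_right (dvd_trans ?_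
    (succ_sub_dvd_choose_mul (3 * n) (n + t) (by omega)))
  rw [show 3 * n + 1 - (n + t) = 2 * n + 1 - t by omega]
  exact Nat.dvd_sub hgn hgt

theorem stmt13 (n j t : ℕ) (hjt : j ≤ t) (htn : t ≤ n) :
    ((2 * (n : ℤ) + 1) * ((n : ℤ) + t + 1)) ∣
      ((3 * n).choose (n + t) : ℤ) * ((2 * n + t).choose t : ℤ) *
        ((n.choose t : ℤ)) * ((t.choose j : ℤ)) *
        (2 * (n : ℤ) ^ 2 + n + 1 - t * ((n : ℤ) - 1)) := by
  set g := Nat.gcd t (2 * n + 1) with hg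
  have hgt : g ∣ t := Nat.gcd_dvd_left _ _
  have hgn : g ∣ 2 * n + 1 := Nat.gcd_dvd_right _ _
  have hgB : (g : ℤ) ∣ ((3 * n).choose (n + t) : ℤ) := by
    exact_mod_cast gcd_dvd_choose_three_mul n t htn
  have hC : (2 * (n : ℤ) + 1) ∣ ((2 * n + t).choose t : ℤ) * g := by
    have h : 2 * n + 1 ∣ (2 * n + t).choose t * g := by
      rw [hg, ← Nat.gcd_mul_left]
      exact Nat.dvd_gcd (succ_dvd_choose_add_mul (2 * n) t) (Dvd.intro_left _ rfl)
    exact_mod_cast h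
  have hB : ((n : ℤ) + t + 1) ∣ ((3 * n).choose (n + t) : ℤ) *
      (2 * (n : ℤ) ^ 2 + n + 1 - t * ((n : ℤ) - 1)) := by
    have h : (3 * (n : ℤ) + 1) * ((3 * n).choose (n + t) : ℤ) =
        ((3 * n + 1).choose (n + t + 1) : ℤ) * ((n : ℤ) + t + 1) := by
      exact_mod_cast Nat.add_one_mul_choose_eq (3 * n) (n + t)
    refine ⟨n * ((3 * n + 1).choose (n + t + 1) : ℤ) -
      (n - 1) * ((3 * n).choose (n + t) : ℤ), ?_⟩
    linear_combination (n : ℤ) * h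
  have hcop : IsCoprime (g : ℤ) ((n : ℤ) + t + 1) := by
    obtain ⟨a, ha⟩ := hgt
    obtain ⟨b, hb⟩ := hgn
    have ha' : (t : ℤ) = g * a := by exact_mod_cast ha
    have hb' : 2 * (n : ℤ) + 1 = g * b := by exact_mod_cast hb
    exact ⟨-b - 2 * a, 2, by linear_combination 2 * ha' + hb'⟩
  have hgB' := hcop.mul_dvd (hgB.mul_right _) hB
  have key : (2 * (n : ℤ) + 1) * ((n : ℤ) + t + 1) ∣
      ((2 * n + t).choose t : ℤ) * (((3 * n).choose (n + t) : ℤ) *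
        (2 * (n : ℤ) ^ 2 + n + 1 - t * ((n : ℤ) - 1))) := by
    refine (mul_dvd_mul_right hC _).trans ?_
    rw [mul_assoc]
    exact mul_dvd_mul_left _ hgB'
  refine (key.mul_right ((n.choose t : ℤ) * (t.choose j : ℤ))).trans (dvd_of_eq ?_)
  ring
end

section
/- For all non-negative integers n and j with j ≤ n, the central binomial coefficient binom(2n,n) divides M_S(2n,j,1). -/
open Polynomial in
/-- Up to sign, the coefficient is the super Catalan number `(2m)! (2r)! / (m! r! (m+r)!)`. -/
theorem factorial_mul_coeff_one_sub_pow_mul_one_add_pow (m r : ℕ) :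
    (m.factorial * r.factorial * (m + r).factorial : ℤ) *
      (((1 - X) ^ (2 * m) * (1 + X) ^ (2 * r) : ℤ[X]).coeff (m + r)) =
      (-1) ^ m * (2 * m).factorial * (2 * r).factorial := by
  induction m generalizing r with
  | zero =>
    simp only [mul_zero, pow_zero, one_mul, zero_add, coeff_one_add_X_pow]
    have h := Nat.choose_mul_factorial_mul_factorial (n := 2 * r) (k := r) (by omega)
    rw [show 2 * r - r = r by omega] at h
    rw [← h]
    push_cast
    simp
    ring
  | succ m ih =>
    have hrec : ((1 - X) ^ (2 * (m + 1)) * (1 + X) ^ (2 * r) : ℤ[X]).coeff (m + 1 + r) =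
        ((1 - X) ^ (2 * m) * (1 + X) ^ (2 * (r + 1)) : ℤ[X]).coeff (m + (r + 1)) -
        4 * ((1 - X) ^ (2 * m) * (1 + X) ^ (2 * r) : ℤ[X]).coeff (m + r) := by
      have hp : ((1 - X) ^ (2 * (m + 1)) * (1 + X) ^ (2 * r) : ℤ[X]) =
          (1 - X) ^ (2 * m) * (1 + X) ^ (2 * (r + 1)) -
          C 4 * ((1 - X) ^ (2 * m) * (1 + X) ^ (2 * r) * X) := by
        rw [show (C 4 : ℤ[X]) = 4 from rfl]
        ring
      rw [hp, coeff_sub, coeff_C_mul, show m + 1 + r = m + r + 1 by ring, coeff_mul_X, add_assoc]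
    have h1 := ih (r + 1)
    have h2 := ih r
    rw [hrec]
    generalize ((1 - X) ^ (2 * m) * (1 + X) ^ (2 * (r + 1)) : ℤ[X]).coeff (m + (r + 1)) = s at *
    generalize ((1 - X) ^ (2 * m) * (1 + X) ^ (2 * r) : ℤ[X]).coeff (m + r) = s' at *
    rw [show m + (r + 1) = m + r + 1 by ring, show 2 * (r + 1) = 2 * r + 1 + 1 by ring] at h1
    rw [show m + 1 + r = m + r + 1 by ring, show 2 * (m + 1) = 2 * m + 1 + 1 by ring]
    simp only [Nat.factorial_succ, Nat.cast_mul, Nat.cast_add, Nat.cast_one, Nat.cast_ofNat] at h1 ⊢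
    apply mul_left_cancel₀ (show ((r : ℤ) + 1) ≠ 0 by positivity)
    linear_combination (m + 1 : ℤ) * h1 - 4 * (m + 1) * (r + 1) * (m + r + 1) * h2

open Polynomial in
theorem choose_mul_coeff_X_pow_mul_one_add_pow {N t k : ℕ} (ht : 2 * t ≤ N) :
    ((N - t).choose t : ℤ) * (X ^ t * (1 + X) ^ (N - 2 * t) : ℤ[X]).coeff k =
      (N - t).choose k * k.choose t := by
  rw [coeff_X_pow_mul']
  split_ifs with h
  · rw [coeff_one_add_X_pow]
    rcases le_or_gt k (N - t) with h' | h'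
    · have := Nat.choose_mul (n := N - t) h
      rw [show N - t - t = N - 2 * t by omega] at this
      exact_mod_cast this.symm
    · rw [Nat.choose_eq_zero_of_lt h', Nat.choose_eq_zero_of_lt (by omega : N - 2 * t < k - t)]
      simp
  · rw [Nat.choose_eq_zero_of_lt (by omega : k < t)]
    simp

open Polynomial in
theorem coeff_one_sub_X_pow_int (n k : ℕ) :
    ((1 - X) ^ n : ℤ[X]).coeff k = (-1) ^ k * n.choose k := by
  have h : ((1 - X) ^ n : ℤ[X]) = ((1 + X) ^ n : ℤ[X]).comp (C (-1) * X) := by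
    simp [sub_eq_add_neg]
  rw [h, comp_C_mul_X_coeff, coeff_one_add_X_pow]
  ring

theorem choose_mul_choose_mul_choose_sub {N k l : ℕ} (hk : k ≤ N) (hl : l ≤ k) :
    N.choose l * (N - l).choose l * (N - 2 * l).choose (k - l) =
      N.choose k * k.choose l * (N - k).choose l := by
  rw [Nat.choose_mul hl, mul_assoc, mul_assoc]
  congr 1
  rcases le_or_gt l (N - k) with h | h
  · have h1 := Nat.choose_mul (n := N - l) (k := N - k) (s := l) h
    rw [show N - l - l = N - 2 * l by omega, ← Nat.choose_symm (n := N - l) (by omega : k - l ≤ N - l),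
      show N - l - (k - l) = N - k by omega, h1,
      ← Nat.choose_symm (n := N - 2 * l) (by omega : k - l ≤ N - 2 * l),
      show N - 2 * l - (k - l) = N - k - l by omega] at *
  · rw [Nat.choose_eq_zero_of_lt h, mul_zero]
    rcases le_or_gt l (N - l) with h' | h'
    · rw [Nat.choose_eq_zero_of_lt (by omega : N - 2 * l < k - l), mul_zero]
    · rw [Nat.choose_eq_zero_of_lt h', zero_mul]

open Polynomial in
theorem choose_mul_coeff_X_pow_mul_one_sub_pow {N l k : ℕ} (hk : k ≤ N) :
    (N.choose l * (N - l).choose l : ℤ) * (X ^ l * (1 - X) ^ (N - 2 * l) : ℤ[X]).coeff k =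
      (-1) ^ (k + l) * (N.choose k * k.choose l * (N - k).choose l) := by
  rw [coeff_X_pow_mul']
  split_ifs with h
  · have h1 := choose_mul_choose_mul_choose_sub hk h
    obtain ⟨d, rfl⟩ := Nat.exists_eq_add_of_le h
    rw [coeff_one_sub_X_pow_int, show l + d + l = d + 2 * l by ring, pow_add, pow_mul]
    rw [← @Nat.cast_inj ℤ] at h1
    push_cast at h1
    rw [← h1, Nat.add_sub_cancel_left]
    simp
    ring
  · rw [Nat.choose_eq_zero_of_lt (by omega : k < l)]
    simp

theorem superCatalan_choose_identity (l m t r : ℕ) (h : l + m = t + r) :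
    (((2 * (l + m)).choose l * (2 * (l + m) - l).choose l * (2 * (l + m) - t).choose t : ℕ) : ℚ) *
      ((2 * m).factorial * (2 * r).factorial) =
    ((2 * (l + m)).choose (l + m) * (l + m).choose l * (l + m).choose t *
      (2 * (l + m) - t).choose l : ℕ) * (m.factorial * r.factorial * (m + r).factorial) := by
  push_cast
  rw [Nat.cast_choose ℚ (by omega : l ≤ 2 * (l + m)),
    Nat.cast_choose ℚ (by omega : l ≤ 2 * (l + m) - l),
    Nat.cast_choose ℚ (by omega : t ≤ 2 * (l + m) - t),
    Nat.cast_choose ℚ (by omega : l + m ≤ 2 * (l + m)),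
    Nat.cast_choose ℚ (by omega : l ≤ l + m),
    Nat.cast_choose ℚ (by omega : t ≤ l + m),
    Nat.cast_choose ℚ (by omega : l ≤ 2 * (l + m) - t),
    show 2 * (l + m) - l - l = 2 * m by omega, show 2 * (l + m) - t - t = 2 * r by omega,
    show 2 * (l + m) - (l + m) = l + m by omega, show l + m - l = m by omega,
    show l + m - t = r by omega, show 2 * (l + m) - t - l = m + r by omega]
  have hf (n : ℕ) : (n.factorial : ℚ) ≠ 0 := by exact_mod_cast n.factorial_ne_zero
  field_simp [hf]

open Finset Polynomial in
theorem alternating_sum_five_choose (n l t : ℕ) (hl : l ≤ n) :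
    ∑ k ∈ range (2 * n + 1), (-1 : ℤ) ^ k *
      ((2 * n).choose k * k.choose l * (2 * n - k).choose l) *
      ((2 * n - t).choose k * k.choose t) =
    (-1) ^ n * ((2 * n).choose n * n.choose l * n.choose t * (2 * n - t).choose l) := by
  rcases lt_or_ge n t with ht | ht
  · rw [Nat.choose_eq_zero_of_lt ht]
    simp only [Nat.cast_zero, mul_zero, zero_mul]
    refine sum_eq_zero fun k _ => ?_
    rcases lt_or_ge k t with h | h
    · rw [Nat.choose_eq_zero_of_lt h]; simp
    · rw [Nat.choose_eq_zero_of_lt (by omega : 2 * n - t < k)]; simp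
  obtain ⟨m, rfl⟩ := Nat.exists_eq_add_of_le hl
  obtain ⟨r, hr⟩ := Nat.exists_eq_add_of_le ht
  have hcoeff : (X ^ l * (1 - X) ^ (2 * (l + m) - 2 * l) *
      (X ^ t * (1 + X) ^ (2 * (l + m) - 2 * t)) : ℤ[X]).coeff (2 * (l + m)) =
      ((1 - X) ^ (2 * m) * (1 + X) ^ (2 * r) : ℤ[X]).coeff (m + r) := by
    rw [show 2 * (l + m) - 2 * l = 2 * m by omega, show 2 * (l + m) - 2 * t = 2 * r by omega,
      show 2 * (l + m) = m + r + (l + t) by omega,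
      show (X ^ l * (1 - X) ^ (2 * m) * (X ^ t * (1 + X) ^ (2 * r)) : ℤ[X]) =
        X ^ (l + t) * ((1 - X) ^ (2 * m) * (1 + X) ^ (2 * r)) by ring, coeff_X_pow_mul]
  have hsum : ∑ k ∈ range (2 * (l + m) + 1), (-1 : ℤ) ^ k *
      ((2 * (l + m)).choose k * k.choose l * (2 * (l + m) - k).choose l) *
      ((2 * (l + m) - t).choose k * k.choose t) =
      (-1) ^ l * ((2 * (l + m)).choose l * (2 * (l + m) - l).choose l *
        (2 * (l + m) - t).choose t) *
        ((1 - X) ^ (2 * m) * (1 + X) ^ (2 * r) : ℤ[X]).coeff (m + r) := by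
    rw [← hcoeff, coeff_mul, Nat.sum_antidiagonal_eq_sum_range_succ_mk, mul_sum]
    refine sum_congr rfl fun k hk => ?_
    have hk' : k ≤ 2 * (l + m) := by simpa [Nat.lt_succ_iff] using hk
    have h1 := choose_mul_coeff_X_pow_mul_one_sub_pow (l := l) hk'
    have h2 := choose_mul_coeff_X_pow_mul_one_add_pow (t := t) (k := 2 * (l + m) - k)
      (by omega : 2 * t ≤ 2 * (l + m))
    have h3 : (2 * (l + m) - t).choose (2 * (l + m) - k) * (2 * (l + m) - k).choose t =
        (2 * (l + m) - t).choose k * k.choose t := by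
      rcases lt_or_ge k t with h | h
      · rw [Nat.choose_eq_zero_of_lt h,
          Nat.choose_eq_zero_of_lt (by omega : 2 * (l + m) - t < 2 * (l + m) - k)]
        simp
      rcases lt_or_ge (2 * (l + m) - k) t with h' | h'
      · rw [Nat.choose_eq_zero_of_lt h',
          Nat.choose_eq_zero_of_lt (by omega : 2 * (l + m) - t < k)]
        simp
      rw [Nat.choose_mul h', Nat.choose_mul h,
        ← Nat.choose_symm (by omega : k - t ≤ 2 * (l + m) - t - t)]
      congr 2
      omega
    rw [← @Nat.cast_inj ℤ] at h3
    push_cast at h3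
    rw [h3] at h2
    rw [← h2]
    have hs : (-1 : ℤ) ^ (k + l) * (-1) ^ l = (-1) ^ k := by
      rw [pow_add, mul_assoc, ← pow_add, ← two_mul, pow_mul]; simp
    rw [← hs]
    linear_combination (-(-1) ^ l * (2 * (l + m) - t).choose t *
      (X ^ t * (1 + X) ^ (2 * (l + m) - 2 * t) : ℤ[X]).coeff (2 * (l + m) - k)) * h1
  rw [hsum]
  have hS := factorial_mul_coeff_one_sub_pow_mul_one_add_pow m r
  have hQ := superCatalan_choose_identity l m t r hr
  have hZ : (((2 * (l + m)).choose l * (2 * (l + m) - l).choose l * (2 * (l + m) - t).choose t : ℤ)) *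
      ((2 * m).factorial * (2 * r).factorial) =
    ((2 * (l + m)).choose (l + m) * (l + m).choose l * (l + m).choose t *
      (2 * (l + m) - t).choose l) * (m.factorial * r.factorial * (m + r).factorial) := by
    exact_mod_cast hQ
  have hf (n : ℕ) : (n.factorial : ℤ) ≠ 0 := by exact_mod_cast n.factorial_ne_zero
  apply mul_left_cancel₀ (mul_ne_zero (mul_ne_zero (hf m) (hf r)) (hf (m + r)))
  rw [pow_add]
  linear_combination ((-1) ^ l * ((2 * (l + m)).choose l * (2 * (l + m) - l).choose l *
        (2 * (l + m) - t).choose t)) * hS + (-1) ^ l * (-1) ^ m * hZ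

open Finset in
theorem alternating_sum_choose_mul_choose_sub (k a b : ℕ) :
    ∑ t ∈ range (k + 1), (-1 : ℤ) ^ t * k.choose t * (b + k - t).choose (a + k) = b.choose a := by
  induction k generalizing a b with
  | zero => simp
  | succ k ih =>
    have h := sum_choose_succ_mul
      (fun t _ => (-1 : ℤ) ^ t * ((b + (k + 1) - t).choose (a + (k + 1)) : ℤ)) k
    have h1 := ih (a + 1) (b + 1)
    have h2 := ih (a + 1) b
    rw [Nat.choose_succ_succ] at h1
    calc _ = ∑ t ∈ range (k + 2), ((k + 1).choose t : ℤ) *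
          ((-1 : ℤ) ^ t * ((b + (k + 1) - t).choose (a + (k + 1)) : ℤ)) :=
          sum_congr rfl fun t _ => by ring
      _ = ∑ t ∈ range (k + 1), (-1 : ℤ) ^ t * k.choose t * (b + 1 + k - t).choose (a + 1 + k) -
          ∑ t ∈ range (k + 1), (-1 : ℤ) ^ t * k.choose t * (b + k - t).choose (a + 1 + k) := by
        rw [h, ← sum_add_distrib, ← sum_sub_distrib]
        refine sum_congr rfl fun t _ => ?_
        rw [show b + (k + 1) - (t + 1) = b + k - t by omega, show b + (k + 1) = b + 1 + k by ring,
          show a + (k + 1) = a + 1 + k by ring]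
        ring
      _ = _ := by
        rw [h1, h2]
        push_cast
        ring

open Finset in
theorem alternating_sum_mul_choose_mul_choose_sub (k a b : ℕ) :
    ∑ t ∈ range (k + 1), (-1 : ℤ) ^ t * t * k.choose t * (b + k - t).choose (a + k) =
      -(k * b.choose (a + 1)) := by
  cases k with
  | zero => simp
  | succ k =>
    rw [sum_range_succ', ← alternating_sum_choose_mul_choose_sub k (a + 1) b, mul_sum,
      ← sum_neg_distrib]
    simp only [Nat.cast_zero, mul_zero, zero_mul, add_zero]
    refine sum_congr rfl fun t _ => ?_
    have h := Nat.add_one_mul_choose_eq k t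
    rw [← @Nat.cast_inj ℤ] at h
    push_cast at h
    rw [show b + (k + 1) - (t + 1) = b + k - t by omega, show a + 1 + k = a + (k + 1) by ring]
    push_cast
    linear_combination ((-1) ^ t * ((b + k - t).choose (a + (k + 1)) : ℤ)) * h

theorem succ_mul_catT (N k : ℕ) : ((N : ℤ) + 1) * catT N k = (N + k).choose N * (N + 1 - k) := by
  have h := Nat.choose_succ_right_eq (N + k) N
  rw [Nat.add_sub_cancel_left, ← @Nat.cast_inj ℤ] at h
  push_cast at h
  unfold catT
  linear_combination -h

open Finset in
theorem succ_mul_catT_mul_catT_sub {N k : ℕ} (hk : k ≤ N) :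
    ((N : ℤ) + 1) * (catT N k * catT N (N - k)) =
      ∑ t ∈ range (N + 1), (-1 : ℤ) ^ t * (1 - t) * (2 * N - t).choose N *
        ((N - t).choose k * k.choose t) := by
  have hterm : ∀ t ∈ range (k + 1), (-1 : ℤ) ^ t * (1 - t) * (2 * N - t).choose N *
        ((N - t).choose k * k.choose t) = (N + k).choose N *
        ((-1 : ℤ) ^ t * k.choose t * (2 * N - k + k - t).choose (N + k) -
          (-1 : ℤ) ^ t * t * k.choose t * (2 * N - k + k - t).choose (N + k)) := by
    intro t ht
    have ht' : t ≤ k := by simpa [Nat.lt_succ_iff] using ht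
    have h : (2 * N - t).choose N * (N - t).choose k =
        (2 * N - t).choose (N + k) * (N + k).choose N := by
      rcases le_or_gt (N + k) (2 * N - t) with h | h
      · rw [Nat.choose_mul (by omega), show 2 * N - t - N = N - t by omega,
          Nat.add_sub_cancel_left]
      · rw [Nat.choose_eq_zero_of_lt h, Nat.choose_eq_zero_of_lt (by omega : N - t < k)]
        simp
    rw [← @Nat.cast_inj ℤ] at h
    push_cast at h
    rw [show 2 * N - k + k - t = 2 * N - t by omega]
    linear_combination ((-1 : ℤ) ^ t * (1 - t) * k.choose t) * h
  have hsum : ∑ t ∈ range (N + 1), (-1 : ℤ) ^ t * (1 - t) * (2 * N - t).choose N *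
        ((N - t).choose k * k.choose t) =
      (N + k).choose N * ((2 * N - k).choose N + k * (2 * N - k).choose (N + 1)) := by
    rw [← sum_subset (range_subset_range.2 (by omega : k + 1 ≤ N + 1)), sum_congr rfl hterm,
      ← mul_sum, sum_sub_distrib, alternating_sum_choose_mul_choose_sub,
      alternating_sum_mul_choose_mul_choose_sub, sub_neg_eq_add]
    intro t _ ht
    rw [Nat.choose_eq_zero_of_lt (n := k) (k := t) (by simp at ht; omega)]
    simp
  rw [hsum]
  have h1 := succ_mul_catT N k
  have h2 := succ_mul_catT N (N - k)
  have h3 := Nat.choose_succ_right_eq (2 * N - k) N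
  rw [show 2 * N - k - N = N - k by omega, ← @Nat.cast_inj ℤ] at h3
  rw [show N + (N - k) = 2 * N - k by omega] at h2
  push_cast [hk] at h2 h3
  apply mul_left_cancel₀ (show ((N : ℤ) + 1) ≠ 0 by positivity)
  linear_combination (((N : ℤ) + 1) * catT N (N - k)) * h1 +
    ((N + k).choose N * ((N : ℤ) + 1 - k)) * h2 - ((N + k).choose N * k : ℤ) * h3

theorem two_mul_add_one_dvd_choose_mul_choose {n t : ℕ} (ht : t ≤ n) :
    2 * n + 1 ∣ (4 * n - t).choose (2 * n) * n.choose t := by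
  obtain ⟨r, hr⟩ := Nat.exists_eq_add_of_le' ht
  rw [← Nat.choose_symm ht, show n - t = r by omega]
  have h1 : 2 * n + 1 ∣ (n + r) * (4 * n - t).choose (2 * n) := by
    have h := Nat.choose_succ_right_eq (4 * n - t) (2 * n)
    rw [show 4 * n - t - 2 * n = n + r by omega] at h
    exact ⟨_, by rw [mul_comm, ← h, mul_comm]⟩
  set g := Nat.gcd (2 * n + 1) (n + r) with hg
  have hg1 : g ∣ 2 * n + 1 := Nat.gcd_dvd_left _ _
  have hg2 : g ∣ n + r := Nat.gcd_dvd_right _ _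
  have h2 : 2 * n + 1 ∣ g * (4 * n - t).choose (2 * n) := by
    rw [hg, ← Nat.gcd_mul_right]
    exact Nat.dvd_gcd (Dvd.intro _ rfl) h1
  refine h2.trans ?_
  rw [mul_comm g]
  refine mul_dvd_mul_left _ ?_
  have hodd : Nat.Coprime g 2 := Nat.Coprime.coprime_dvd_left hg1 (by simp)
  cases r with
  | zero =>
    have : g ∣ 1 := by
      rw [show 1 = 2 * n + 1 - 2 * (n + 0) by omega]
      exact Nat.dvd_sub hg1 (hg2.mul_left 2)
    exact this.trans (one_dvd _)
  | succ r =>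
    have hr : g ∣ 2 * r + 1 := by
      rw [show 2 * r + 1 = 2 * (n + (r + 1)) - (2 * n + 1) by omega]
      exact Nat.dvd_sub (hg2.mul_left 2) hg1
    have hcop : Nat.Coprime g (r + 1) := by
      refine Nat.Coprime.coprime_dvd_left hr ?_
      rw [Nat.coprime_iff_gcd_eq_one, ← Nat.dvd_one]
      have ha := Nat.gcd_dvd_left (2 * r + 1) (r + 1)
      have hb := Nat.gcd_dvd_right (2 * r + 1) (r + 1)
      have := Nat.dvd_sub (hb.mul_left 2) ha
      rwa [show 2 * (r + 1) - (2 * r + 1) = 1 by omega] at this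
    have hsub : g ∣ n - r := by
      refine hodd.dvd_of_dvd_mul_left ?_
      rw [show 2 * (n - r) = 2 * n + 1 - (2 * r + 1) by omega]
      exact Nat.dvd_sub hg1 hr
    refine hcop.dvd_of_dvd_mul_right ?_
    rw [Nat.choose_succ_right_eq]
    exact hsub.mul_left _

open Finset in
theorem centralBinom_dvd_sum_choose_mul_F (n l : ℕ) :
    ((2 * n).choose n : ℤ) ∣ ∑ k ∈ range (2 * n + 1),
      ((2 * n).choose k * k.choose l * (2 * n - k).choose l : ℤ) * F n k := by
  rcases lt_or_ge n l with hl | hl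
  · rw [sum_eq_zero]
    · exact dvd_zero _
    intro k _
    rcases lt_or_ge k l with h | h
    · rw [Nat.choose_eq_zero_of_lt h]; simp
    · rw [Nat.choose_eq_zero_of_lt (by omega : 2 * n - k < l)]; simp
  have hcast : ((2 * n : ℕ) : ℤ) + 1 ≠ 0 := by positivity
  rw [← mul_dvd_mul_iff_left hcast, mul_sum]
  have hexp : ∑ k ∈ range (2 * n + 1), (((2 * n : ℕ) : ℤ) + 1) *
      (((2 * n).choose k * k.choose l * (2 * n - k).choose l : ℤ) * F n k) =
      ∑ t ∈ range (2 * n + 1), (-1 : ℤ) ^ t * (1 - t) * (4 * n - t).choose (2 * n) *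
        ((-1) ^ n * ((2 * n).choose n * n.choose l * n.choose t * (2 * n - t).choose l)) := by
    simp_rw [← alternating_sum_five_choose n l _ hl, mul_sum]
    rw [sum_comm]
    refine sum_congr rfl fun k hk => ?_
    have h := succ_mul_catT_mul_catT_sub (N := 2 * n) (k := k) (by simpa [Nat.lt_succ_iff] using hk)
    rw [show 2 * (2 * n) = 4 * n by ring] at h
    unfold F
    calc _ = ((-1) ^ k * ((2 * n).choose k * k.choose l * (2 * n - k).choose l : ℤ)) *
          ((((2 * n : ℕ) : ℤ) + 1) * (catT (2 * n) k * catT (2 * n) (2 * n - k))) := by ring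
      _ = _ := by
        rw [h, mul_sum]
        exact sum_congr rfl fun t _ => by ring
  rw [hexp]
  refine dvd_sum fun t _ => ?_
  rcases lt_or_ge n t with ht | ht
  · rw [Nat.choose_eq_zero_of_lt ht]; simp
  have h := Int.natCast_dvd_natCast.2 (two_mul_add_one_dvd_choose_mul_choose ht)
  push_cast at h
  obtain ⟨c, hc⟩ := h
  refine ⟨(-1 : ℤ) ^ t * (1 - t) * (-1) ^ n * n.choose l * (2 * n - t).choose l * c, ?_⟩
  push_cast
  linear_combination ((-1 : ℤ) ^ t * (1 - t) * (-1) ^ n * n.choose l * (2 * n - t).choose l *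
    (2 * n).choose n) * hc

open Finset in
theorem sum_choose_mul_choose_mul_choose {N j k : ℕ} (hj : j ≤ k) (hk : k ≤ N) :
    ∑ l ∈ range (k + 1), l.choose j * (k.choose l * (N - k).choose l) =
      k.choose j * (N - j).choose k := by
  rw [show N - j = N - k + (k - j) by omega, Nat.add_choose_eq,
    Nat.sum_antidiagonal_eq_sum_range_succ_mk, mul_sum]
  refine sum_congr rfl fun l hl => ?_
  have hl' : l ≤ k := by simpa [Nat.lt_succ_iff] using hl
  rcases lt_or_ge l j with h | h
  · rw [Nat.choose_eq_zero_of_lt h, Nat.choose_eq_zero_of_lt (by omega : k - j < k - l)]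
    simp
  · rw [← mul_assoc, mul_comm (l.choose j), Nat.choose_mul h,
      ← Nat.choose_symm (by omega : l - j ≤ k - j), show k - j - (l - j) = k - l by omega]
    ring

open Finset in
theorem MS_one_eq_sum {n j : ℕ} (hj : j ≤ n) :
    MS n j 1 = ∑ l ∈ range (2 * n + 1), (l.choose j : ℤ) * ∑ k ∈ range (2 * n + 1),
      ((2 * n).choose k * k.choose l * (2 * n - k).choose l : ℤ) * F n k := by
  have hinner : ∀ k ∈ range (2 * n + 1), ∑ l ∈ range (2 * n + 1), (l.choose j : ℤ) *
      (((2 * n).choose k * k.choose l * (2 * n - k).choose l : ℤ) * F n k) =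
      (k.choose j * (2 * n - j).choose k : ℤ) * ((2 * n).choose k * F n k) := by
    intro k hk
    have hk' : k ≤ 2 * n := by simpa [Nat.lt_succ_iff] using hk
    rw [← sum_subset (range_subset_range.2 (by omega : k + 1 ≤ 2 * n + 1))]
    · rcases lt_or_ge k j with h | h
      · rw [Nat.choose_eq_zero_of_lt h, Nat.cast_zero, zero_mul, zero_mul]
        refine sum_eq_zero fun l hl => ?_
        rw [Nat.choose_eq_zero_of_lt (n := l) (k := j) (by simp at hl; omega)]
        simp
      have hs := sum_choose_mul_choose_mul_choose h hk'
      rw [← @Nat.cast_inj ℤ] at hs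
      push_cast at hs
      rw [← hs, sum_mul]
      exact sum_congr rfl fun l _ => by ring
    · intro l _ hl
      rw [Nat.choose_eq_zero_of_lt (n := k) (k := l) (by simp at hl; omega)]
      simp
  simp_rw [mul_sum]
  rw [sum_comm, sum_congr rfl hinner, show 2 * n + 1 = j + (2 * n - 2 * j + 1) + j by omega,
    sum_range_add _ (j + (2 * n - 2 * j + 1)), sum_range_add _ j, sum_eq_zero, zero_add,
    sum_eq_zero (s := range j), add_zero]
  · rw [MS, mul_sum]
    refine sum_congr rfl fun v _ => ?_
    have h := Nat.choose_mul (n := 2 * n - j) (Nat.le_add_right j v)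
    rw [show 2 * n - j - j = 2 * n - 2 * j by omega, Nat.add_sub_cancel_left,
      ← @Nat.cast_inj ℤ] at h
    push_cast at h
    linear_combination (-((2 * n).choose (j + v) : ℤ) * F n (j + v)) * h
  · intro v _
    rw [Nat.choose_eq_zero_of_lt (by omega : 2 * n - j < j + (2 * n - 2 * j + 1) + v)]
    simp
  · intro v hv
    rw [Nat.choose_eq_zero_of_lt (n := v) (k := j) (by simpa using hv)]
    simp

theorem stmt14 (n j : ℕ) (hj : j ≤ n) :
    (((2 * n).choose n : ℤ)) ∣ MS n j 1 := by
  rw [MS_one_eq_sum hj]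
  exact Finset.dvd_sum fun l _ => (centralBinom_dvd_sum_choose_mul_F n l).mul_left _
end
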